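/- For every real number q with 0 < q < 1, the character of the τ-twisted W₃(4/5)-module W^τ(1/8) has the Rogers–Ramanujan product form: χ_{5,6}^{1,2}(q) + χ_{5,6}^{1,4}(q) = q^{11/120} · ∏_{n=0}^∞ 1/((1 − q^{(5n+2)/2})(1 − q^{(5n+3)/2})). -/

import Mathlib

open scoped BigOperators

/-- The Euler product `(q)_∞ = ∏_{i=1}^∞ (1 - q^i)`. -/
noncomputable def eulerProd (q : ℝ) : ℝ := ∏' i : ℕ, (1 - q ^ (i + 1))

/-- The Virasoro minimal model character `χ_{s,t}^{m,n}(q)`: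
`q^(h - c/24) · (q)_∞⁻¹ · Σ_{k∈ℤ} q^(s t k²) (q^(k(mt-ns)) - q^((mt+ns)k+mn))`,
where `c = 1 - 6(s-t)²/(st)` and `h = ((mt-ns)² - (s-t)²)/(4st)`. -/
noncomputable def minChar (s t m n : ℤ) (q : ℝ) : ℝ :=
  q ^ ((((((m * t - n * s) ^ 2 - (s - t) ^ 2 : ℤ) : ℝ)) / (4 * (s : ℝ) * (t : ℝ))) -
        (1 - 6 * ((s : ℝ) - (t : ℝ)) ^ 2 / ((s : ℝ) * (t : ℝ))) / 24) *
    (eulerProd q)⁻¹ *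
    ∑' k : ℤ, ((q ^ (s * t * k ^ 2 + k * (m * t - n * s)) : ℝ) -
               (q ^ (s * t * k ^ 2 + (m * t + n * s) * k + m * n) : ℝ))

open Filter Topology

/-- The infinite `q`-Pochhammer symbol `(a; q)_∞ = ∏_{i=0}^∞ (1 - a q^i)`. -/
noncomputable def qPoch (q a : ℝ) : ℝ := ∏' i : ℕ, (1 - a * q ^ i)

section qPoch

variable {q : ℝ}

lemma summable_norm_neg_mul_pow (hq0 : 0 < q) (hq1 : q < 1) (a : ℝ) :
    Summable fun i : ℕ => ‖-(a * q ^ i)‖ := by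
  simpa only [norm_neg] using
    ((summable_geometric_of_lt_one hq0.le hq1).mul_left a).norm

lemma multipliable_qPoch (hq0 : 0 < q) (hq1 : q < 1) (a : ℝ) :
    Multipliable fun i : ℕ => 1 - a * q ^ i := by
  simpa only [sub_eq_add_neg] using
    multipliable_one_add_of_summable (summable_norm_neg_mul_pow hq0 hq1 a)

lemma tendsto_prod_qPoch (hq0 : 0 < q) (hq1 : q < 1) (a : ℝ) :
    Tendsto (fun n => ∏ i ∈ Finset.range n, (1 - a * q ^ i)) atTop (𝓝 (qPoch q a)) :=
  (multipliable_qPoch hq0 hq1 a).tendsto_prod_tprod_nat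

lemma qPoch_eq_prod_mul (hq0 : 0 < q) (hq1 : q < 1) (a : ℝ) (n : ℕ) :
    qPoch q a = (∏ i ∈ Finset.range n, (1 - a * q ^ i)) * qPoch q (a * q ^ n) := by
  have h := ((tendsto_prod_qPoch hq0 hq1 (a * q ^ n)).const_mul
    (∏ i ∈ Finset.range n, (1 - a * q ^ i)))
  refine tendsto_nhds_unique ((tendsto_prod_qPoch hq0 hq1 a).comp (tendsto_add_atTop_nat n)) ?_
  refine h.congr fun m => ?_
  simp only [Function.comp_apply]
  rw [add_comm m n, Finset.prod_range_add]
  simp only [pow_add, mul_assoc]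

lemma qPoch_eq_mul (hq0 : 0 < q) (hq1 : q < 1) {a b : ℝ} (hb : b = a * q) :
    qPoch q a = (1 - a) * qPoch q b := by
  simpa [hb] using qPoch_eq_prod_mul hq0 hq1 a 1

lemma qPoch_ne_zero (hq0 : 0 < q) (hq1 : q < 1) {a : ℝ} (ha1 : a < 1) : qPoch q a ≠ 0 := by
  have h := tprod_one_add_ne_zero_of_summable (f := fun i : ℕ => -(a * q ^ i)) (fun i => ?_)
    (summable_norm_neg_mul_pow hq0 hq1 a)
  · simpa only [← sub_eq_add_neg, qPoch] using h
  · have h1 : q ^ i ≤ 1 := pow_le_one₀ hq0.le hq1.le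
    have h2 : 0 < q ^ i := pow_pos hq0 i
    rw [← sub_eq_add_neg]
    have : a * q ^ i < 1 := by nlinarith
    linarith

lemma qPoch_nonneg (hq0 : 0 < q) (hq1 : q < 1) {a : ℝ} (ha1 : a ≤ 1) : 0 ≤ qPoch q a := by
  refine ge_of_tendsto' (tendsto_prod_qPoch hq0 hq1 a) fun n => Finset.prod_nonneg fun i _ => ?_
  have h1 : q ^ i ≤ 1 := pow_le_one₀ hq0.le hq1.le
  have h2 : 0 < q ^ i := pow_pos hq0 i
  nlinarith

lemma qPoch_le_one (hq0 : 0 < q) (hq1 : q < 1) {a : ℝ} (ha0 : 0 ≤ a) (ha1 : a ≤ 1) :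
    qPoch q a ≤ 1 := by
  refine le_of_tendsto' (tendsto_prod_qPoch hq0 hq1 a) fun n =>
    Finset.prod_le_one (fun i _ => ?_) fun i _ => ?_
  · have h1 : q ^ i ≤ 1 := pow_le_one₀ hq0.le hq1.le
    have h2 : 0 < q ^ i := pow_pos hq0 i
    nlinarith
  · have : 0 ≤ a * q ^ i := by positivity
    linarith

lemma tendsto_qPoch_mul_pow (hq0 : 0 < q) (hq1 : q < 1) {a : ℝ} (ha1 : a < 1) :
    Tendsto (fun n : ℕ => qPoch q (a * q ^ n)) atTop (𝓝 1) := by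
  have hne := qPoch_ne_zero hq0 hq1 ha1
  have h := (tendsto_const_nhds (x := qPoch q a)).div (tendsto_prod_qPoch hq0 hq1 a) hne
  rw [div_self hne] at h
  refine h.congr fun n => ?_
  rw [Pi.div_apply, div_eq_iff, mul_comm]
  · exact qPoch_eq_prod_mul hq0 hq1 a n
  · intro h0
    exact hne (by rw [qPoch_eq_prod_mul hq0 hq1 a n, h0, zero_mul])

lemma tendsto_qPoch_zpow_mul (hq0 : 0 < q) (hq1 : q < 1) (a : ℝ) (c : ℤ) :
    Tendsto (fun n : ℕ => qPoch q (a * q ^ ((n : ℤ) + c))) atTop (𝓝 1) := by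
  obtain ⟨N, hN⟩ : ∃ N : ℕ, a * q ^ (c + N) < 1 := by
    have h0 : Tendsto (fun n : ℕ => a * q ^ c * q ^ n) atTop (𝓝 0) := by
      simpa using (tendsto_pow_atTop_nhds_zero_of_lt_one hq0.le hq1).const_mul (a * q ^ c)
    obtain ⟨N, hN⟩ := (h0.eventually (gt_mem_nhds one_pos)).exists
    exact ⟨N, by rwa [zpow_add₀ hq0.ne', zpow_natCast, ← mul_assoc]⟩
  rw [← tendsto_add_atTop_iff_nat N]
  refine (tendsto_qPoch_mul_pow hq0 hq1 hN).congr fun n => ?_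
  rw [mul_assoc, ← zpow_natCast q n, ← zpow_add₀ hq0.ne']
  congr 3
  push_cast
  ring

lemma qPoch_zpow_eq_zero (hq0 : 0 < q) {c : ℤ} (hc : c ≤ 0) : qPoch q (q ^ c) = 0 := by
  obtain ⟨n, rfl⟩ := Int.exists_eq_neg_ofNat hc
  refine tprod_of_exists_eq_zero ⟨n, ?_⟩
  rw [← zpow_natCast q n, ← zpow_add₀ hq0.ne']
  simp

lemma qPoch_dissection (hq0 : 0 < q) (hq1 : q < 1) (a : ℝ) {r : ℕ} (hr : r ≠ 0) :
    qPoch q a = ∏ j ∈ Finset.range r, qPoch (q ^ r) (a * q ^ j) := by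
  have h := tendsto_finsetProd (Finset.range r) fun j _ =>
    tendsto_prod_qPoch (pow_pos hq0 r) (pow_lt_one₀ hq0.le hq1 hr) (a * q ^ j)
  refine tendsto_nhds_unique ((tendsto_prod_qPoch hq0 hq1 a).comp
    (tendsto_id.const_mul_atTop' (Nat.pos_of_ne_zero hr))) (h.congr fun n => ?_)
  rw [Finset.prod_comm]
  simp only [Function.comp_apply, id]
  induction n with
  | zero => simp
  | succ n ih =>
    rw [Finset.prod_range_succ, ih, mul_add_one, Finset.prod_range_add]
    congr 1
    refine Finset.prod_congr rfl fun j _ => ?_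
    ring

end qPoch

section Quintuple

variable {q x : ℝ}

/-- The coefficient `(-1)^k x^(3k) q^(k(3k-1)/2)` of the quintuple product series. -/
noncomputable def quintCoeff (q x : ℝ) (k : ℤ) : ℝ :=
  (-1) ^ k * x ^ (3 * k) * q ^ (k * (3 * k - 1) / 2)

/-- The `k`-th term of the finite quintuple product identity, in bilateral form. -/
noncomputable def quintTerm (q x : ℝ) (m n k : ℤ) : ℝ :=
  (1 + x * q ^ k) * quintCoeff q x k * (qPoch q (q ^ (m + k + 1)) * qPoch q (q ^ (n - k + 1)) *
    qPoch q (x ^ 2 * q ^ (n + k + 1)) * qPoch q (q ^ (m - k + 1) / x ^ 2))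

/-- The telescoping certificate for the finite quintuple product identity. -/
noncomputable def quintCert (q x : ℝ) (m n k : ℤ) : ℝ :=
  -q ^ (n - k + 1) * quintCoeff q x k * (qPoch q (q ^ (m + k)) * qPoch q (q ^ (n - k + 2)) *
    qPoch q (x ^ 2 * q ^ (n + k + 1)) * qPoch q (q ^ (m - k + 1) / x ^ 2))

lemma quintCoeff_succ (hq0 : 0 < q) (hx0 : 0 < x) (k : ℤ) :
    quintCoeff q x (k + 1) = -quintCoeff q x k * x ^ 3 * q ^ (3 * k + 1) := by
  have h : (k + 1) * (3 * (k + 1) - 1) / 2 = k * (3 * k - 1) / 2 + (3 * k + 1) := by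
    rw [← Int.add_mul_ediv_right _ _ two_ne_zero]
    congr 1
    ring
  rw [quintCoeff, quintCoeff, h, zpow_add₀ hq0.ne', mul_add_one, zpow_add₀ hx0.ne',
    zpow_add_one₀ (by norm_num : (-1 : ℝ) ≠ 0), zpow_ofNat x 3]
  ring

lemma quintTerm_succ_sub (hq0 : 0 < q) (hq1 : q < 1) (hx0 : 0 < x) (m n k : ℤ) :
    (1 - q ^ (m + n + 1)) * (1 - x * q ^ (n + 1)) * quintTerm q x m (n + 1) k
      - quintTerm q x m n k = quintCert q x m n (k + 1) - quintCert q x m n k := by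
  have hq := hq0.ne'
  have hx := hx0.ne'
  have h1 : qPoch q (q ^ (m + k)) = (1 - q ^ (m + k)) * qPoch q (q ^ (m + k + 1)) :=
    qPoch_eq_mul hq0 hq1 (zpow_add_one₀ hq _)
  have h2 : qPoch q (q ^ (n - k + 1)) = (1 - q ^ (n - k + 1)) * qPoch q (q ^ (n - k + 2)) :=
    qPoch_eq_mul hq0 hq1 (by rw [← zpow_add_one₀ hq]; ring_nf)
  have h3 : qPoch q (x ^ 2 * q ^ (n + k + 1)) =
      (1 - x ^ 2 * q ^ (n + k + 1)) * qPoch q (x ^ 2 * q ^ (n + k + 2)) :=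
    qPoch_eq_mul hq0 hq1 (by rw [mul_assoc, ← zpow_add_one₀ hq]; ring_nf)
  have h4 : qPoch q (q ^ (m - k) / x ^ 2) =
      (1 - q ^ (m - k) / x ^ 2) * qPoch q (q ^ (m - k + 1) / x ^ 2) :=
    qPoch_eq_mul hq0 hq1 (by rw [zpow_add_one₀ hq]; ring)
  have e1 : m + (k + 1) = m + k + 1 := by ring
  have e2 : n - (k + 1) + 1 = n - k := by ring
  have e3 : n - (k + 1) + 2 = n - k + 1 := by ring
  have e4 : n + (k + 1) + 1 = n + k + 2 := by ring
  have e5 : m - (k + 1) + 1 = m - k := by ring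
  have e6 : n + 1 - k + 1 = n - k + 2 := by ring
  have e7 : n + 1 + k + 1 = n + k + 2 := by ring
  rw [quintTerm, quintTerm, quintCert, quintCert, e1, e2, e3, e4, e5, e6, e7, h1, h2, h3, h4,
    quintCoeff_succ hq0 hx0]
  have key : (1 - q ^ (m + n + 1)) * (1 - x * q ^ (n + 1)) * (1 + x * q ^ k)
      - (1 - q ^ (n - k + 1)) * (1 - x ^ 2 * q ^ (n + k + 1)) * (1 + x * q ^ k) =
      q ^ (n - k) * x ^ 3 * q ^ (3 * k + 1) * (1 - q ^ (n - k + 1)) * (1 - q ^ (m - k) / x ^ 2)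
      + q ^ (n - k + 1) * (1 - q ^ (m + k)) * (1 - x ^ 2 * q ^ (n + k + 1)) := by
    have h3k : q ^ (3 * k) = (q ^ k) ^ 3 := by rw [mul_comm, zpow_mul]; norm_cast
    simp only [zpow_add₀ hq, zpow_sub₀ hq, zpow_one, h3k]
    have hk : q ^ k ≠ 0 := zpow_ne_zero _ hq
    field_simp
    ring
  linear_combination (quintCoeff q x k * qPoch q (q ^ (m + k + 1)) * qPoch q (q ^ (n - k + 2)) *
    qPoch q (x ^ 2 * q ^ (n + k + 2)) * qPoch q (q ^ (m - k + 1) / x ^ 2)) * key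

lemma quintTerm_base (hq0 : 0 < q) (hx0 : 0 < x) (hqx : q < x ^ 2) (hx1 : x < 1) (m : ℕ) :
    quintTerm q x m (-m) (-m) * (qPoch q x * qPoch q (q / x)) =
      qPoch q q * qPoch q q * qPoch q (x * q ^ (-m + 1 : ℤ)) * qPoch q (q ^ (m + 1 : ℤ) / x) *
        (qPoch q (x ^ 2) * qPoch q (q / x ^ 2)) := by
  have hq := hq0.ne'
  have hx := hx0.ne'
  have hq1 : q < 1 := by nlinarith
  induction m with
  | zero =>
    have h1 : qPoch q x = (1 - x) * qPoch q (x * q) := qPoch_eq_mul hq0 hq1 rfl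
    have h2 : qPoch q (x ^ 2) = (1 - x ^ 2) * qPoch q (x ^ 2 * q) := qPoch_eq_mul hq0 hq1 rfl
    simp [quintTerm, quintCoeff, h1, h2]
    ring
  | succ m ih =>
    have hm1 : q ^ (m : ℤ) ≤ 1 := by
      rw [zpow_natCast]
      exact pow_le_one₀ hq0.le hq1.le
    have hne : 1 - q ^ (m + 1 : ℤ) / x ≠ 0 := by
      rw [zpow_add_one₀ hq, sub_ne_zero, ne_comm, Ne, div_eq_iff hx]
      nlinarith
    have h1 : qPoch q (x ^ 2 * q ^ (-2 * m - 1 : ℤ)) = (1 - x ^ 2 * q ^ (-2 * m - 1 : ℤ)) *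
        ((1 - x ^ 2 * q ^ (-2 * m : ℤ)) * qPoch q (x ^ 2 * q ^ (-2 * m + 1 : ℤ))) := by
      rw [qPoch_eq_mul hq0 hq1 (b := x ^ 2 * q ^ (-2 * m : ℤ)), qPoch_eq_mul hq0 hq1]
      · rw [zpow_add_one₀ hq, mul_assoc]
      · rw [mul_assoc, ← zpow_add_one₀ hq, sub_add_cancel]
    have h2 : qPoch q (q ^ (2 * m + 1 : ℤ) / x ^ 2) = (1 - q ^ (2 * m + 1 : ℤ) / x ^ 2) *
        ((1 - q ^ (2 * m + 2 : ℤ) / x ^ 2) * qPoch q (q ^ (2 * m + 3 : ℤ) / x ^ 2)) := by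
      rw [qPoch_eq_mul hq0 hq1 (b := q ^ (2 * m + 2 : ℤ) / x ^ 2), qPoch_eq_mul hq0 hq1]
      · rw [div_mul_eq_mul_div, ← zpow_add_one₀ hq]
        ring_nf
      · rw [div_mul_eq_mul_div, ← zpow_add_one₀ hq]
        ring_nf
    have h3 : qPoch q (x * q ^ (-m : ℤ)) =
        (1 - x * q ^ (-m : ℤ)) * qPoch q (x * q ^ (-m + 1 : ℤ)) :=
      qPoch_eq_mul hq0 hq1 (by rw [mul_assoc, ← zpow_add_one₀ hq])
    have h4 : qPoch q (q ^ (m + 1 : ℤ) / x) =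
        (1 - q ^ (m + 1 : ℤ) / x) * qPoch q (q ^ (m + 2 : ℤ) / x) :=
      qPoch_eq_mul hq0 hq1 (by rw [div_mul_eq_mul_div, ← zpow_add_one₀ hq]; ring_nf)
    have h5 : quintCoeff q x (-m) = -quintCoeff q x (-m - 1) * x ^ 3 * q ^ (-3 * m - 2 : ℤ) := by
      have h := quintCoeff_succ hq0 hx0 (-m - 1)
      rw [sub_add_cancel] at h
      rw [h]
      ring_nf
    rw [quintTerm, add_neg_cancel, zero_add, neg_sub_neg, sub_self, zero_add, zpow_one,
      show (-m + -m + 1 : ℤ) = -2 * m + 1 by ring, show (m - -m + 1 : ℤ) = 2 * m + 1 by ring,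
      h2, h4, h5] at ih
    rw [quintTerm]
    push_cast
    rw [add_neg_cancel, zero_add, neg_sub_neg, sub_self, zero_add, zpow_one,
      show (-(m + 1) + -(m + 1) + 1 : ℤ) = -2 * m - 1 by ring,
      show (m + 1 - -(m + 1) + 1 : ℤ) = 2 * m + 3 by ring,
      show (-(m + 1) : ℤ) = -m - 1 by ring, sub_add_cancel,
      show (m + 1 + 1 : ℤ) = m + 2 by ring, h1, h3]
    refine mul_right_cancel₀ hne ?_
    have key : (1 + x * q ^ (-m - 1 : ℤ)) * (1 - x ^ 2 * q ^ (-2 * m - 1 : ℤ)) *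
        (1 - x ^ 2 * q ^ (-2 * m : ℤ)) * (1 - q ^ (m + 1 : ℤ) / x) =
        -(1 - x * q ^ (-m : ℤ)) * (1 + x * q ^ (-m : ℤ)) * x ^ 3 * q ^ (-3 * m - 2 : ℤ) *
        (1 - q ^ (2 * m + 1 : ℤ) / x ^ 2) * (1 - q ^ (2 * m + 2 : ℤ) / x ^ 2) := by
      have hy : q ^ m ≠ 0 := pow_ne_zero m hq
      simp only [zpow_add₀ hq, zpow_sub₀ hq, neg_mul, zpow_neg, zpow_mul', zpow_natCast,
        zpow_ofNat]
      field_simp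
      ring
    linear_combination (1 - x * q ^ (-m : ℤ)) * ih + quintCoeff q x (-m - 1) * qPoch q q *
      qPoch q q * qPoch q (x ^ 2 * q ^ (-2 * m + 1 : ℤ)) * qPoch q (q ^ (2 * m + 3 : ℤ) / x ^ 2) *
      (qPoch q x * qPoch q (q / x)) * key

lemma one_sub_mul_zpow_ne_zero (hq0 : 0 < q) (hqx : q < x) (hx1 : x < 1) (c : ℤ) :
    1 - x * q ^ c ≠ 0 := by
  have hq1 : q < 1 := hqx.trans hx1
  rcases le_or_gt 0 c with hc | hc
  · have h1 : q ^ c ≤ 1 := zpow_le_one₀ hq0 hq1.le hc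
    have h2 : 0 < q ^ c := zpow_pos hq0 c
    nlinarith
  · have h1 : q⁻¹ ≤ q ^ c := by
      rw [← zpow_neg_one]
      exact zpow_le_zpow_right_of_le_one₀ hq0 hq1.le (by lia)
    have h2 : 1 < x * q⁻¹ := by rwa [← div_eq_mul_inv, one_lt_div hq0]
    nlinarith

lemma sum_quintTerm (hq0 : 0 < q) (hx0 : 0 < x) (hqx : q < x ^ 2) (hx1 : x < 1) (m N : ℕ) :
    (∑ j ∈ Finset.range (N + 1), quintTerm q x m (N - m) (j - m)) *
        (qPoch q x * qPoch q (q / x)) =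
      qPoch q q * qPoch q (q ^ (N + 1)) * qPoch q (x * q ^ (N - m + 1 : ℤ)) *
        qPoch q (q ^ (m + 1 : ℤ) / x) * (qPoch q (x ^ 2) * qPoch q (q / x ^ 2)) := by
  have hq := hq0.ne'
  have hq1 : q < 1 := by nlinarith
  induction N with
  | zero => simpa using quintTerm_base hq0 hx0 hqx hx1 m
  | succ N ih =>
    have htel := Finset.sum_range_sub (fun j : ℕ => quintCert q x m (N - m) (j - m)) (N + 2)
    have hlast : quintCert q x m (N - m) ((N + 2 : ℕ) - m) = 0 := by
      have : qPoch q (q ^ (N - m - ((N + 2 : ℕ) - m) + 2 : ℤ)) = 0 :=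
        qPoch_zpow_eq_zero hq0 (by push_cast; lia)
      rw [quintCert, this]
      ring
    have hfirst : quintCert q x m (N - m) ((0 : ℕ) - m) = 0 := by
      have : qPoch q (q ^ (m + ((0 : ℕ) - m) : ℤ)) = 0 := qPoch_zpow_eq_zero hq0 (by simp)
      rw [quintCert, this]
      ring
    have hextra : quintTerm q x m (N - m) ((N + 1 : ℕ) - m) = 0 := by
      have : qPoch q (q ^ (N - m - ((N + 1 : ℕ) - m) + 1 : ℤ)) = 0 :=
        qPoch_zpow_eq_zero hq0 (by push_cast; lia)
      rw [quintTerm, this]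
      ring
    rw [hlast, hfirst, sub_zero] at htel
    have hstep (j : ℕ) : (1 - q ^ (N + 1)) * (1 - x * q ^ (N - m + 1 : ℤ)) *
        quintTerm q x m ((N + 1 : ℕ) - m) (j - m) - quintTerm q x m (N - m) (j - m) =
        quintCert q x m (N - m) ((j + 1 : ℕ) - m) - quintCert q x m (N - m) (j - m) := by
      have h := quintTerm_succ_sub hq0 hq1 hx0 m (N - m) (j - m)
      rw [show (m + (N - m) + 1 : ℤ) = (N + 1 : ℕ) by push_cast; ring, zpow_natCast,
        show (N - m + 1 : ℤ) = (N + 1 : ℕ) - m by push_cast; ring,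
        show (j - m + 1 : ℤ) = (j + 1 : ℕ) - m by push_cast; ring] at h
      rw [show (N - m + 1 : ℤ) = (N + 1 : ℕ) - m by push_cast; ring, h]
    rw [← Finset.sum_congr rfl fun j _ => hstep j, Finset.sum_sub_distrib, ← Finset.mul_sum,
      Finset.sum_range_succ (fun j : ℕ => quintTerm q x m (N - m) (j - m)), hextra, add_zero,
      sub_eq_zero] at htel
    have h1 : qPoch q (q ^ (N + 1)) = (1 - q ^ (N + 1)) * qPoch q (q ^ (N + 1 + 1)) :=
      qPoch_eq_mul hq0 hq1 (pow_succ _ _)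
    have h2 : qPoch q (x * q ^ (N - m + 1 : ℤ)) =
        (1 - x * q ^ (N - m + 1 : ℤ)) * qPoch q (x * q ^ ((N + 1 : ℕ) - m + 1 : ℤ)) :=
      qPoch_eq_mul hq0 hq1 (by rw [mul_assoc, ← zpow_add_one₀ hq]; push_cast; ring_nf)
    rw [← htel, h1, h2] at ih
    have hne : (1 - q ^ (N + 1)) * (1 - x * q ^ (N - m + 1 : ℤ)) ≠ 0 :=
      mul_ne_zero (sub_pos.2 (pow_lt_one₀ hq0.le hq1 N.succ_ne_zero)).ne'
        (one_sub_mul_zpow_ne_zero hq0 (by nlinarith) hx1 _)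
    refine mul_left_cancel₀ hne ?_
    linear_combination ih

lemma tsum_quintTerm (hq0 : 0 < q) (hx0 : 0 < x) (hqx : q < x ^ 2) (hx1 : x < 1) (m : ℕ) :
    (∑' k : ℤ, quintTerm q x m m k) * (qPoch q x * qPoch q (q / x)) =
      qPoch q q * qPoch q (q ^ (m + m + 1)) * qPoch q (x * q ^ (m + 1 : ℤ)) *
        qPoch q (q ^ (m + 1 : ℤ) / x) * (qPoch q (x ^ 2) * qPoch q (q / x ^ 2)) := by
  have h := sum_quintTerm hq0 hx0 hqx hx1 m (m + m)
  rw [Nat.cast_add, add_sub_cancel_right] at h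
  rw [← h, ← (Equiv.subRight (m : ℤ)).tsum_eq, tsum_eq_sum
    (s := (Finset.range (m + m + 1)).map Nat.castEmbedding), Finset.sum_map]
  · rfl
  · intro k hk
    rw [Equiv.subRight_apply]
    rcases lt_or_ge k 0 with hk0 | hk0
    · rw [quintTerm, qPoch_zpow_eq_zero hq0 (c := m + (k - m) + 1) (by lia)]
      ring
    · lift k to ℕ using hk0
      have hk' : m + m + 1 ≤ k := by simpa using hk
      rw [quintTerm, qPoch_zpow_eq_zero hq0 (c := m - (k - m) + 1) (by lia)]
      ring

lemma abs_quintTerm_le (hq0 : 0 < q) (hx0 : 0 < x) (hqx : q < x ^ 2) (hx1 : x < 1) (m : ℕ)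
    (k : ℤ) : |quintTerm q x m m k| ≤ (1 + x * q ^ k) * |quintCoeff q x k| := by
  have hq1 : q < 1 := by nlinarith
  have hpos : 0 < 1 + x * q ^ k := by positivity
  rw [quintTerm, abs_mul, abs_mul, abs_of_pos hpos]
  refine mul_le_of_le_one_right (by positivity) ?_
  by_cases hk : -(m : ℤ) ≤ k ∧ k ≤ m
  · obtain ⟨hk1, hk2⟩ := hk
    have hz {c : ℤ} (hc : 0 ≤ c) : q ^ c ≤ 1 := zpow_le_one₀ hq0 hq1.le hc
    have hx2 : x ^ 2 ≤ 1 := pow_le_one₀ hx0.le hx1.le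
    have hm : q ^ (m - k + 1) / x ^ 2 ≤ 1 := by
      rw [div_le_one (by positivity), zpow_add_one₀ hq0.ne']
      nlinarith [hz (sub_nonneg.2 hk2)]
    have hp : x ^ 2 * q ^ (m + k + 1) ≤ 1 :=
      mul_le_one₀ hx2 (by positivity) (hz (by lia))
    have hb {a : ℝ} (h0 : 0 ≤ a) (h1 : a ≤ 1) : 0 ≤ qPoch q a ∧ qPoch q a ≤ 1 :=
      ⟨qPoch_nonneg hq0 hq1 h1, qPoch_le_one hq0 hq1 h0 h1⟩
    obtain ⟨a0, a1⟩ := hb (by positivity) (hz (show 0 ≤ m + k + 1 by lia))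
    obtain ⟨b0, b1⟩ := hb (by positivity) (hz (show 0 ≤ m - k + 1 by lia))
    obtain ⟨c0, c1⟩ := hb (by positivity) hp
    obtain ⟨d0, d1⟩ := hb (by positivity) hm
    rw [abs_of_nonneg (by positivity)]
    exact mul_le_one₀ (mul_le_one₀ (mul_le_one₀ a1 b0 b1) c0 c1) d0 d1
  · rcases lt_or_ge k (-m) with hk0 | hk0
    · simp [qPoch_zpow_eq_zero hq0 (c := m + k + 1) (by lia)]
    · simp [qPoch_zpow_eq_zero hq0 (c := m - k + 1) (by lia)]

lemma abs_quintCoeff (hq0 : 0 < q) (hx0 : 0 < x) (k : ℤ) :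
    |quintCoeff q x k| = x ^ (3 * k) * q ^ (k * (3 * k - 1) / 2) := by
  rw [quintCoeff, abs_mul, abs_mul, abs_zpow, abs_neg, abs_one, one_zpow, one_mul,
    abs_of_pos (zpow_pos hx0 _), abs_of_pos (zpow_pos hq0 _)]

lemma summable_quintCoeff_bound (hq0 : 0 < q) (hx0 : 0 < x) (hqx : q < x ^ 2) (hx1 : x < 1) :
    Summable fun k : ℤ => (1 + x * q ^ k) * |quintCoeff q x k| := by
  have hq1 : q < 1 := by nlinarith
  have hanti {a b : ℤ} (h : a ≤ b) : q ^ b ≤ q ^ a := zpow_le_zpow_right_of_le_one₀ hq0 hq1.le h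
  refine Summable.of_nat_of_neg ?_ ?_
  · refine ((summable_geometric_of_lt_one hq0.le hq1).mul_left 2).of_nonneg_of_le
      (fun n => by positivity) fun n => ?_
    rw [abs_quintCoeff hq0 hx0]
    have h1 : q ^ (n : ℤ) ≤ 1 := zpow_le_one₀ hq0 hq1.le (by simp)
    have h2 : x ^ (3 * n : ℤ) ≤ 1 := zpow_le_one₀ hx0 hx1.le (by positivity)
    have h3 : q ^ (n * (3 * n - 1) / 2 : ℤ) ≤ q ^ (n : ℤ) := by
      refine hanti ?_
      rw [Int.le_ediv_iff_mul_le two_pos]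
      rcases Nat.eq_zero_or_pos n with rfl | hn
      · simp
      · have : (1 : ℤ) ≤ n := mod_cast hn
        nlinarith
    have h4 : 1 + x * q ^ (n : ℤ) ≤ 2 := by
      have := mul_le_one₀ hx1.le (by positivity) h1
      linarith
    rw [← zpow_natCast q n]
    refine mul_le_mul h4 ?_ (by positivity) two_pos.le
    exact (mul_le_of_le_one_left (by positivity) h2).trans h3
  · have hr : q ^ 2 / x ^ 3 < 1 := by
      rw [div_lt_one (by positivity)]
      calc q ^ 2 < (x ^ 2) ^ 2 := pow_lt_pow_left₀ hqx hq0.le two_ne_zero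
        _ = x * x ^ 3 := by ring
        _ < x ^ 3 := mul_lt_of_lt_one_left (by positivity) hx1
    refine ((summable_geometric_of_lt_one (by positivity) hr).mul_left (2 / q)).of_nonneg_of_le
      (fun n => by positivity) fun n => ?_
    rw [abs_quintCoeff hq0 hx0]
    have h1 : 1 ≤ q ^ (-n : ℤ) := one_le_zpow_of_nonpos₀ hq0 hq1.le (by simp)
    have h3 : q ^ (-n * (3 * -n - 1) / 2 : ℤ) ≤ q ^ (3 * n - 1 : ℤ) := by
      refine hanti ?_
      rw [Int.le_ediv_iff_mul_le two_pos]
      rcases Nat.lt_or_ge n 2 with hn | hn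
      · interval_cases n <;> simp
      · have : (2 : ℤ) ≤ n := mod_cast hn
        nlinarith
    have h4 : 1 + x * q ^ (-n : ℤ) ≤ 2 * q ^ (-n : ℤ) := by nlinarith
    calc _ ≤ 2 * q ^ (-n : ℤ) * (x ^ (3 * -n : ℤ) * q ^ (3 * n - 1 : ℤ)) := by gcongr
      _ = 2 / q * (q ^ 2 / x ^ 3) ^ n := by
        have hq := hq0.ne'
        have hx := hx0.ne'
        have hn : q ^ n ≠ 0 := pow_ne_zero n hq
        have hn' : x ^ n ≠ 0 := pow_ne_zero n hx
        simp only [zpow_sub₀ hq, mul_neg, zpow_neg, zpow_mul', zpow_natCast, zpow_ofNat,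
          div_pow]
        field_simp
        ring

/-- The quintuple product identity. -/
theorem hasSum_quintuple (hq0 : 0 < q) (hx0 : 0 < x) (hqx : q < x ^ 2) (hx1 : x < 1) :
    HasSum (fun k : ℤ => (1 + x * q ^ k) * quintCoeff q x k)
      (qPoch q q * qPoch q (x ^ 2) * qPoch q (q / x ^ 2) / (qPoch q x * qPoch q (q / x))) := by
  have hq1 : q < 1 := by nlinarith
  have hθ : qPoch q x * qPoch q (q / x) ≠ 0 :=
    mul_ne_zero (qPoch_ne_zero hq0 hq1 hx1)
      (qPoch_ne_zero hq0 hq1 (by rw [div_lt_one hx0]; nlinarith))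
  have hsum : Summable fun k : ℤ => (1 + x * q ^ k) * quintCoeff q x k := by
    refine (summable_quintCoeff_bound hq0 hx0 hqx hx1).of_norm_bounded fun k => ?_
    have : 0 < 1 + x * q ^ k := by positivity
    rw [norm_mul, Real.norm_of_nonneg this.le, Real.norm_eq_abs]
  convert hsum.hasSum using 1
  have hone : Tendsto (fun m : ℕ => qPoch q (q ^ (m + m + 1))) atTop (𝓝 1) := by
    refine ((tendsto_qPoch_mul_pow hq0 hq1 hq1).comp
      (tendsto_id.const_mul_atTop' two_pos)).congr fun m => ?_
    simp only [Function.comp_apply, id, ← pow_succ', two_mul]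
  have hlim : Tendsto (fun m : ℕ => ∑' k : ℤ, quintTerm q x m m k) atTop
      (𝓝 (∑' k : ℤ, (1 + x * q ^ k) * quintCoeff q x k)) := by
    refine tendsto_tsum_of_dominated_convergence (summable_quintCoeff_bound hq0 hx0 hqx hx1)
      (fun k => ?_) (.of_forall fun m k => abs_quintTerm_le hq0 hx0 hqx hx1 m k)
    have h1 := tendsto_qPoch_zpow_mul hq0 hq1 1 (k + 1)
    have h2 := tendsto_qPoch_zpow_mul hq0 hq1 1 (-k + 1)
    have h3 := tendsto_qPoch_zpow_mul hq0 hq1 (x ^ 2) (k + 1)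
    have h4 := tendsto_qPoch_zpow_mul hq0 hq1 (x ^ 2)⁻¹ (-k + 1)
    have h := (((h1.mul h2).mul h3).mul h4).const_mul ((1 + x * q ^ k) * quintCoeff q x k)
    simpa only [quintTerm, one_mul, mul_one, ← add_assoc, ← sub_eq_add_neg, inv_mul_eq_div] using h
  have h1 := tendsto_qPoch_zpow_mul hq0 hq1 x 1
  have h2 := tendsto_qPoch_zpow_mul hq0 hq1 x⁻¹ 1
  have hR := (((hone.const_mul (qPoch q q)).mul h1).mul h2).mul_const
    (qPoch q (x ^ 2) * qPoch q (q / x ^ 2))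
  have hL := hlim.mul_const (qPoch q x * qPoch q (q / x))
  rw [div_eq_iff hθ, mul_assoc]
  refine tendsto_nhds_unique ?_ hL
  simpa [tsum_quintTerm hq0 hx0 hqx hx1, inv_mul_eq_div] using hR

end Quintuple

section Character

variable {X : ℝ}

lemma summable_zpow_quadratic (hX0 : 0 < X) (hX1 : X < 1) {a : ℤ} (ha : 0 < a) (b c : ℤ) :
    Summable fun k : ℤ => X ^ (a * k ^ 2 + b * k + c) := by
  have hle (k : ℤ) : X ^ (a * k ^ 2 + b * k + c) ≤ X ^ (c - (|b| + 1) ^ 2) * X ^ |k| := by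
    rw [← zpow_add₀ hX0.ne']
    refine zpow_le_zpow_right_of_le_one₀ hX0 hX1.le ?_
    have h1 : -(|b| * |k|) ≤ b * k := by rw [← abs_mul]; exact neg_abs_le _
    have h2 : |k| ^ 2 = k ^ 2 := sq_abs k
    have h3 : k ^ 2 ≤ a * k ^ 2 := le_mul_of_one_le_left (sq_nonneg k) ha
    nlinarith [sq_nonneg (|k| - (|b| + 1)), sq_nonneg (|k|), abs_nonneg b, abs_nonneg k]
  refine Summable.of_nonneg_of_le (fun k => (zpow_pos hX0 _).le) hle (Summable.mul_left _ ?_)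
  have h := summable_geometric_of_lt_one hX0.le hX1
  refine Summable.of_nat_of_neg ?_ ?_ <;> simpa using h

lemma HasSum.int_even_add_odd {f : ℤ → ℝ} {s : ℝ} (hf : HasSum f s) :
    HasSum (fun k : ℤ => f (2 * k) + f (2 * k + 1)) s := by
  have he : Function.Injective fun k : ℤ => 2 * k := fun a b h => by simpa using h
  have ho : Function.Injective fun k : ℤ => 2 * k + 1 := fun a b h => by simpa using h
  have hse := hf.summable.comp_injective he
  have hso := hf.summable.comp_injective ho
  have h : HasSum f (∑' k, f (2 * k) + ∑' k, f (2 * k + 1)) := by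
    refine (he.hasSum_range_iff.2 hse.hasSum).add_isCompl ?_ (ho.hasSum_range_iff.2 hso.hasSum)
    simpa using Int.isCompl_even_odd
  rw [hf.unique h]
  exact hse.hasSum.add hso.hasSum

lemma quintuple_summand (hX0 : 0 < X) (k : ℤ) :
    (1 + X ^ 3 * (X ^ 10) ^ k) * quintCoeff (X ^ 10) (X ^ 3) k =
      (-1) ^ k * (X ^ (15 * k ^ 2 + 4 * k) + X ^ (15 * k ^ 2 + 14 * k + 3)) := by
  have hX := hX0.ne'
  have hk : 2 * (k * (3 * k - 1) / 2) = k * (3 * k - 1) :=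
    Int.two_mul_ediv_two_of_even (by
      rcases Int.even_or_odd k with h | h
      · exact h.mul_right _
      · exact Even.mul_left (by obtain ⟨j, rfl⟩ := h; exact ⟨3 * j + 1, by ring⟩) _)
  have h1 : (X ^ 3) ^ (3 * k) * (X ^ 10) ^ (k * (3 * k - 1) / 2) = X ^ (15 * k ^ 2 + 4 * k) := by
    rw [← zpow_natCast X 3, ← zpow_natCast X 10, ← zpow_mul, ← zpow_mul, ← zpow_add₀ hX]
    congr 1
    push_cast
    linear_combination 5 * hk
  have h2 : X ^ 3 * (X ^ 10) ^ k * X ^ (15 * k ^ 2 + 4 * k) = X ^ (15 * k ^ 2 + 14 * k + 3) := by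
    rw [← zpow_natCast X 3, ← zpow_natCast X 10, ← zpow_mul, ← zpow_add₀ hX, ← zpow_add₀ hX]
    congr 1
    push_cast
    ring
  rw [quintCoeff, mul_assoc, h1, ← h2]
  ring

lemma hasSum_characters (hX0 : 0 < X) (hX1 : X < 1) :
    HasSum (fun k : ℤ => (X ^ (60 * k ^ 2 + -8 * k + 0) - X ^ (60 * k ^ 2 + 32 * k + 4)) +
        (X ^ (60 * k ^ 2 + -28 * k + 3) - X ^ (60 * k ^ 2 + 52 * k + 11)))
      (qPoch (X ^ 10) (X ^ 10) * qPoch (X ^ 10) (X ^ 6) * qPoch (X ^ 10) (X ^ 4) /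
        (qPoch (X ^ 10) (X ^ 3) * qPoch (X ^ 10) (X ^ 7))) := by
  have h := (hasSum_quintuple (q := X ^ 10) (x := X ^ 3) (by positivity) (by positivity)
    (by rw [← pow_mul]; exact pow_lt_pow_right_of_lt_one₀ hX0 hX1 (by norm_num))
    (pow_lt_one₀ hX0.le hX1 (by norm_num)))
  have e1 : X ^ 10 / (X ^ 3) ^ 2 = X ^ 4 := by field_simp
  have e2 : X ^ 10 / X ^ 3 = X ^ 7 := by field_simp
  rw [e1, e2, ← pow_mul] at h
  simp only [quintuple_summand hX0] at h
  refine ((Equiv.neg ℤ).hasSum_iff.2 h).int_even_add_odd.congr_fun fun k => ?_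
  have ho : (-1 : ℝ) ^ (-(2 * k + 1)) = -1 := Odd.neg_one_zpow ⟨-k - 1, by ring⟩
  have he : (-1 : ℝ) ^ (-(2 * k)) = 1 := Even.neg_one_zpow ⟨-k, by ring⟩
  simp only [Function.comp_apply, Equiv.neg_apply, ho, he]
  ring_nf

lemma eulerProd_eq_qPoch (q : ℝ) : eulerProd q = qPoch q q := by
  simp only [eulerProd, qPoch, pow_succ']

lemma tprod_inv_eq (hX0 : 0 < X) (hX1 : X < 1) :
    ∏' n : ℕ, ((1 - (X ^ 2) ^ ((5 * (n : ℝ) + 2) / 2)) *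
        (1 - (X ^ 2) ^ ((5 * (n : ℝ) + 3) / 2)))⁻¹ =
      (qPoch (X ^ 5) (X ^ 2) * qPoch (X ^ 5) (X ^ 3))⁻¹ := by
  have h50 : 0 < X ^ 5 := by positivity
  have h51 : X ^ 5 < 1 := pow_lt_one₀ hX0.le hX1 (by norm_num)
  have hpow (n j : ℕ) : (X ^ 2) ^ ((5 * (n : ℝ) + j) / 2) = X ^ j * (X ^ 5) ^ n := by
    rw [← Real.rpow_natCast X 2, ← Real.rpow_mul hX0.le, ← pow_mul, ← pow_add,
      ← Real.rpow_natCast]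
    congr 1
    push_cast
    ring
  have hprod := (multipliable_qPoch h50 h51 (X ^ 2)).hasProd.mul
    (multipliable_qPoch h50 h51 (X ^ 3)).hasProd
  have hne : qPoch (X ^ 5) (X ^ 2) * qPoch (X ^ 5) (X ^ 3) ≠ 0 :=
    mul_ne_zero (qPoch_ne_zero h50 h51 (pow_lt_one₀ hX0.le hX1 (by norm_num)))
      (qPoch_ne_zero h50 h51 (pow_lt_one₀ hX0.le hX1 (by norm_num)))
  refine (tprod_congr fun n => ?_).trans (hprod.inv₀ hne).tprod_eq
  have h2 := hpow n 2
  have h3 := hpow n 3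
  push_cast at h2 h3
  rw [h2, h3]

lemma quintuple_eq_rogersRamanujan (hX0 : 0 < X) (hX1 : X < 1) :
    qPoch (X ^ 10) (X ^ 10) * qPoch (X ^ 10) (X ^ 6) * qPoch (X ^ 10) (X ^ 4) /
        (qPoch (X ^ 10) (X ^ 3) * qPoch (X ^ 10) (X ^ 7)) =
      eulerProd (X ^ 2) * (qPoch (X ^ 5) (X ^ 2) * qPoch (X ^ 5) (X ^ 3))⁻¹ := by
  have hlt {n : ℕ} (hn : n ≠ 0) : X ^ n < 1 := pow_lt_one₀ hX0.le hX1 hn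
  have h2 := qPoch_dissection (q := X ^ 2) (by positivity) (hlt two_ne_zero) (X ^ 2)
    (r := 5) (by norm_num)
  have h52 := qPoch_dissection (q := X ^ 5) (by positivity) (hlt (by norm_num)) (X ^ 2)
    (r := 2) (by norm_num)
  have h53 := qPoch_dissection (q := X ^ 5) (by positivity) (hlt (by norm_num)) (X ^ 3)
    (r := 2) (by norm_num)
  simp only [Finset.prod_range_succ, Finset.prod_range_zero, ← pow_mul, ← pow_add, one_mul]
    at h2 h52 h53
  norm_num at h2 h52 h53
  have hne {n : ℕ} (hn : n ≠ 0) : qPoch (X ^ 10) (X ^ n) ≠ 0 :=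
    qPoch_ne_zero (by positivity) (hlt (by norm_num)) (hlt hn)
  have n2 := hne (n := 2) (by norm_num)
  have n3 := hne (n := 3) (by norm_num)
  have n7 := hne (n := 7) (by norm_num)
  have n8 := hne (n := 8) (by norm_num)
  rw [eulerProd_eq_qPoch, h2, h52, h53]
  field_simp

end Character

theorem twisted_character_one_eighth_product_form (q : ℝ) (hq0 : 0 < q) (hq1 : q < 1) :
    minChar 5 6 1 2 q + minChar 5 6 1 4 q =
      q ^ ((11 : ℝ) / 120) *
        ∏' n : ℕ, ((1 - q ^ ((5 * (n : ℝ) + 2) / 2)) * (1 - q ^ ((5 * (n : ℝ) + 3) / 2)))⁻¹ := by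
  obtain ⟨X, hX0, rfl⟩ : ∃ X : ℝ, 0 < X ∧ X ^ 2 = q :=
    ⟨√q, Real.sqrt_pos.2 hq0, Real.sq_sqrt hq0.le⟩
  have hX1 : X < 1 := (pow_lt_one_iff_of_nonneg hX0.le two_ne_zero).1 hq1
  have hX := hX0.ne'
  have hs := @summable_zpow_quadratic X hX0 hX1 60 (by norm_num)
  have hsum := (hasSum_characters hX0 hX1).tsum_eq
  rw [((hs _ _).sub (hs _ _)).tsum_add ((hs _ _).sub (hs _ _)),
    quintuple_eq_rogersRamanujan hX0 hX1] at hsum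
  have hpow (n : ℤ) : (X ^ 2) ^ n = X ^ (2 * n) := by
    rw [zpow_mul, zpow_ofNat]
  have h1 : ∑' k : ℤ, ((X ^ 2) ^ (30 * k ^ 2 + k * -4) -
      (X ^ 2) ^ (30 * k ^ 2 + 16 * k + 2)) =
      ∑' k : ℤ, (X ^ (60 * k ^ 2 + -8 * k + 0) - X ^ (60 * k ^ 2 + 32 * k + 4)) := by
    refine tsum_congr fun k => ?_
    rw [hpow, hpow]
    ring_nf
  have h2 : X ^ 3 * ∑' k : ℤ, ((X ^ 2) ^ (30 * k ^ 2 + k * -14) -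
      (X ^ 2) ^ (30 * k ^ 2 + 26 * k + 4)) =
      ∑' k : ℤ, (X ^ (60 * k ^ 2 + -28 * k + 3) - X ^ (60 * k ^ 2 + 52 * k + 11)) := by
    rw [← tsum_mul_left]
    refine tsum_congr fun k => ?_
    rw [hpow, hpow, mul_sub, ← zpow_natCast X 3, ← zpow_add₀ hX, ← zpow_add₀ hX]
    push_cast
    ring_nf
  have h3 : (X ^ 2) ^ ((191 : ℝ) / 120) = (X ^ 2) ^ ((11 : ℝ) / 120) * X ^ 3 := by
    rw [show (191 : ℝ) / 120 = 11 / 120 + 3 / 2 by norm_num, Real.rpow_add hq0]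
    congr 1
    rw [← Real.rpow_natCast X 2, ← Real.rpow_mul hX0.le, ← Real.rpow_natCast]
    norm_num
  have hE : eulerProd (X ^ 2) ≠ 0 := by
    rw [eulerProd_eq_qPoch]
    exact qPoch_ne_zero hq0 hq1 hq1
  rw [tprod_inv_eq hX0 hX1, minChar, minChar]
  norm_num only [Int.cast_ofNat]
  rw [h1, h3]
  linear_combination (X ^ 2) ^ ((11 : ℝ) / 120) * (eulerProd (X ^ 2))⁻¹ * (hsum + h2) +
    (X ^ 2) ^ ((11 : ℝ) / 120) * (qPoch (X ^ 5) (X ^ 2) * qPoch (X ^ 5) (X ^ 3))⁻¹ *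
      inv_mul_cancel₀ hE
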